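/- For an integer G ≥ 2 and p ∈ (0,1), define f(G,p) = (Σ_{k=⌊Gp⌋+1}^{G−1} (G choose k) p^k (1−p)^{G−k}) / (1 − (1−p)^G − p^G), which equals the conditional probability P(p̂ > p | S) of underestimating the advantage. Then for every integer G ≥ 6, the average over a uniformly distributed difficulty on (0, 2/G) satisfies (G/2) · ∫_0^{2/G} f(G,p) dp > 0.78. -/

import Mathlib

open Finset MeasureTheory

/-- `overshootProb G p` is the conditional probability `P(p̂ > p | S)` that the empirical
baseline of a binomial(G, p) group overestimates `p` given the non-degenerate event
`S = {1 ≤ R ≤ G−1}`, expressed as a ratio of binomial sums: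
`(Σ_{k=⌊Gp⌋+1}^{G−1} C(G,k) p^k (1−p)^(G−k)) / (1 − (1−p)^G − p^G)`. -/
noncomputable def overshootProb (G : ℕ) (p : ℝ) : ℝ :=
  (∑ k ∈ Finset.Icc (⌊(G : ℝ) * p⌋₊ + 1) (G - 1),
      (G.choose k : ℝ) * p ^ k * (1 - p) ^ (G - k))
    / (1 - (1 - p) ^ G - p ^ G)

/-- Degree-8 Taylor polynomial at `p = 0` of `(1 - p)⁻ⁿ`, in Horner form. -/
noncomputable def negBinomTaylor (n p : ℝ) : ℝ :=
  1 + n * p * (1 + (n + 1) * p / 2 * (1 + (n + 2) * p / 3 * (1 + (n + 3) * p / 4 *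
    (1 + (n + 4) * p / 5 * (1 + (n + 5) * p / 6 * (1 + (n + 6) * p / 7 *
      (1 + (n + 7) * p / 8)))))))

/-- A polynomial minorant of `P(S) / P(R = 1)` at `p = x * e`, `G = 1 / e`. -/
noncomputable def ratioMinorant (x e : ℝ) : ℝ :=
  1 + (1 - e) * x / 2 + (1 - e ^ 2) * x ^ 2 / 6 + (1 + 2 * e - 4 / 3 * e ^ 2) * x ^ 3 / 24
    + (1 + 5 * e + 4 * e ^ 2) * x ^ 4 / 120 + (1 + 9 * e + 25 * e ^ 2) * x ^ 5 / 720
    + (1 + 14 * e + 70 * e ^ 2) * x ^ 6 / 5040 + (1 + 20 * e + 154 * e ^ 2) * x ^ 7 / 40320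
    - x ^ 5 / 6144

/-- A polynomial majorant of `P(R = 1 | S)` at `p = (1 + t) / G`, `G = 6 / s`. -/
noncomputable def condOneMajorant (s t : ℝ) : ℝ :=
  (2917 / 5000 - 3431 / 10000 * t + 463 / 5000 * t ^ 2 - 159 / 10000 * t ^ 3)
    + s * (107 / 5000 - 53 / 2500 * t - 49 / 1000 * t ^ 2 + 131 / 5000 * t ^ 3)

/-- The proof writes the difference in the Bernstein basis, with positive coefficients. -/
lemma one_le_condOneMajorant_mul_ratioMinorant {s t : ℝ} (hs0 : 0 ≤ s) (hs1 : s ≤ 1)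
    (ht0 : 0 ≤ t) (ht1 : t ≤ 1) :
    1 ≤ condOneMajorant s t * ratioMinorant (1 + t) (s / 6) := by
  obtain ⟨r, hr⟩ : ∃ r, r = 1 - t := ⟨_, rfl⟩
  obtain ⟨z, hz⟩ : ∃ z, z = 1 - s := ⟨_, rfl⟩
  have hr0 : 0 ≤ r := by linarith
  have hz0 : 0 ≤ z := by linarith
  have key : condOneMajorant s t * ratioMinorant (1 + t) (s / 6) - 1 = (
        z ^ 3 * (136377846 * r ^ 10
          + 982037745 * t * r ^ 9
          + 4141650780 * t ^ 2 * r ^ 8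
          + 13930452711 * t ^ 3 * r ^ 7
          + 35183551356 * t ^ 4 * r ^ 6
          + 61024686642 * t ^ 5 * r ^ 5
          + 70085358540 * t ^ 6 * r ^ 4
          + 51998685120 * t ^ 7 * r ^ 3
          + 23765935392 * t ^ 8 * r ^ 2
          + 6000390432 * t ^ 9 * r
          + 623355840 * t ^ 10)
        + s * z ^ 2 * (515902860 * r ^ 10
          + 4329205629 * t * r ^ 9
          + 17897254302 * t ^ 2 * r ^ 8
          + 48371586213 * t ^ 3 * r ^ 7
          + 92599430592 * t ^ 4 * r ^ 6
          + 126508708416 * t ^ 5 * r ^ 5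
          + 120858637944 * t ^ 6 * r ^ 4
          + 77820310992 * t ^ 7 * r ^ 3
          + 31718320320 * t ^ 8 * r ^ 2
          + 7235757696 * t ^ 9 * r
          + 675915648 * t ^ 10)
        + s ^ 2 * z * (419887686 * r ^ 10
          + 3755431039 * t * r ^ 9
          + 15692024616 * t ^ 2 * r ^ 8
          + 40007855493 * t ^ 3 * r ^ 7
          + 67970807788 * t ^ 4 * r ^ 6
          + 79152683242 * t ^ 5 * r ^ 5
          + 63095387020 * t ^ 6 * r ^ 4
          + 33697609568 * t ^ 7 * r ^ 3
          + 11578778144 * t ^ 8 * r ^ 2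
          + 2389116320 * t ^ 9 * r
          + 245692352 * t ^ 10)
        + s ^ 3 * (35652960 * r ^ 10
          + 362967555 * t * r ^ 9
          + 1771659910 * t ^ 2 * r ^ 8
          + 5326591415 * t ^ 3 * r ^ 7
          + 10618671560 * t ^ 4 * r ^ 6
          + 14330834140 * t ^ 5 * r ^ 5
          + 13073917920 * t ^ 6 * r ^ 4
          + 7960238160 * t ^ 7 * r ^ 3
          + 3190779520 * t ^ 8 * r ^ 2
          + 833396800 * t ^ 9 * r
          + 123473920 * t ^ 10)) / 58060800000 := by
    subst hr hz
    unfold condOneMajorant ratioMinorant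
    ring
  have hpos : 0 ≤ condOneMajorant s t * ratioMinorant (1 + t) (s / 6) - 1 := by
    rw [key]
    positivity
  linarith

lemma pow_mul_negBinomTaylor_le_one {p : ℝ} (hp0 : 0 ≤ p) (hp1 : p ≤ 1) (n : ℕ) :
    (1 - p) ^ n * negBinomTaylor n p ≤ 1 := by
  induction n with
  | zero => simp [negBinomTaylor]
  | succ n ih =>
    have hrec : (1 - p) * negBinomTaylor (n + 1) p = negBinomTaylor n p
        - p ^ 9 * ((n + 1) * (n + 2) * (n + 3) * (n + 4) * (n + 5) * (n + 6) * (n + 7) * (n + 8))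
          / 40320 := by
      unfold negBinomTaylor
      ring
    have hle : (1 - p) * negBinomTaylor (n + 1) p ≤ negBinomTaylor n p := by
      rw [hrec]
      have : 0 ≤ p ^ 9 * (((n : ℝ) + 1) * (n + 2) * (n + 3) * (n + 4) * (n + 5) * (n + 6)
        * (n + 7) * (n + 8)) / 40320 := by positivity
      linarith
    calc (1 - p) ^ (n + 1) * negBinomTaylor ((n + 1 : ℕ) : ℝ) p
        = (1 - p) ^ n * ((1 - p) * negBinomTaylor (n + 1) p) := by push_cast; ring
      _ ≤ (1 - p) ^ n * negBinomTaylor n p :=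
          mul_le_mul_of_nonneg_left hle (pow_nonneg (by linarith) n)
      _ ≤ 1 := ih

lemma mul_ratioMinorant_le {x e n p : ℝ} (hx : 0 ≤ x) (he0 : 0 ≤ e) (he1 : e ≤ 1 / 6)
    (hp : p = x * e) (hn : n * e = 1 - e) :
    x * ratioMinorant x e ≤ negBinomTaylor n p - (1 - p) - x ^ 6 / 6144 := by
  have hstep : ∀ j : ℝ, (n + j) * p = x * (1 + (j - 1) * e) := by
    intro j
    rw [hp]
    linear_combination x * hn
  have hT : negBinomTaylor n p = 1 + x * (1 - e) * (1 + x / 2 * (1 + x * (1 + e) / 3 *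
      (1 + x * (1 + 2 * e) / 4 * (1 + x * (1 + 3 * e) / 5 * (1 + x * (1 + 4 * e) / 6 *
        (1 + x * (1 + 5 * e) / 7 * (1 + x * (1 + 6 * e) / 8))))))) := by
    have h0 := hstep 0
    rw [add_zero] at h0
    unfold negBinomTaylor
    rw [h0, hstep 1, hstep 2, hstep 3, hstep 4, hstep 5, hstep 6, hstep 7]
    ring
  have e2 : e ^ 2 ≤ (1 / 6) ^ 2 := pow_le_pow_left₀ he0 he1 2
  have e3 : e ^ 3 ≤ (1 / 6) ^ 3 := pow_le_pow_left₀ he0 he1 3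
  have e4 : e ^ 4 ≤ (1 / 6) ^ 4 := pow_le_pow_left₀ he0 he1 4
  have e2_nonneg : 0 ≤ e ^ 2 := pow_nonneg he0 2
  have h4 : 0 ≤ x ^ 4 * (e ^ 2 * (1 / 3 - 2 * e)) / 24 := by
    have : 0 ≤ 1 / 3 - 2 * e := by linarith
    positivity
  have h5 : 0 ≤ x ^ 5 * (e ^ 2 * (1 - 5 * e - 6 * e ^ 2)) / 120 := by
    have : 0 ≤ 1 - 5 * e - 6 * e ^ 2 := by linarith
    positivity
  have h6 : 0 ≤ x ^ 6 * (e ^ 3 * (15 - 26 * e - 24 * e ^ 2)) / 720 := by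
    have : 0 ≤ 15 - 26 * e - 24 * e ^ 2 := by linarith
    positivity
  have h7 : 0 ≤ x ^ 7 * (e ^ 3 * (140 + 49 * e - 154 * e ^ 2 - 120 * e ^ 3)) / 5040 := by
    have : 0 ≤ 140 + 49 * e - 154 * e ^ 2 - 120 * e ^ 3 := by linarith
    positivity
  have h8 : 0 ≤ x ^ 8 * (e ^ 3 * (560 + 889 * e + 140 * e ^ 2 - 1044 * e ^ 3 - 720 * e ^ 4))
      / 40320 := by
    have : 0 ≤ 560 + 889 * e + 140 * e ^ 2 - 1044 * e ^ 3 - 720 * e ^ 4 := by linarith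
    positivity
  rw [hT, hp]
  unfold ratioMinorant
  linarith

lemma pow_succ_le_pow_mul {x p : ℝ} {n : ℕ} (hn : 5 ≤ n) (hp0 : 0 ≤ p) (hp : p ≤ 1 / 2)
    (hpx : p ≤ x / 6) (hpx' : p ≤ (1 - p) * (x / 4)) :
    p ^ (n + 1) ≤ (1 - p) ^ n * (x ^ 6 / 6144) := by
  obtain ⟨m, rfl⟩ := Nat.exists_eq_add_of_le hn
  have hm : p ^ m ≤ (1 - p) ^ m := pow_le_pow_left₀ hp0 (by linarith) m
  have h5 : p ^ 5 ≤ ((1 - p) * (x / 4)) ^ 5 := pow_le_pow_left₀ hp0 hpx' 5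
  have hq : 0 ≤ 1 - p := by linarith
  have hx : 0 ≤ x := by linarith
  calc p ^ (5 + m + 1) = p ^ 5 * p ^ m * p := by ring
    _ ≤ ((1 - p) * (x / 4)) ^ 5 * (1 - p) ^ m * (x / 6) := by gcongr
    _ = (1 - p) ^ (5 + m) * (x ^ 6 / 6144) := by ring

lemma one_sub_pow_sub_pow_pos {G : ℕ} (hG : 2 ≤ G) {p : ℝ} (hp0 : 0 < p) (hp1 : p < 1) :
    0 < 1 - (1 - p) ^ G - p ^ G := by
  have h1 : p ^ G < p := pow_lt_self_of_lt_one₀ hp0 hp1 (by omega)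
  have h2 : (1 - p) ^ G < 1 - p :=
    pow_lt_self_of_lt_one₀ (by linarith) (by linarith) (by omega)
  linarith

lemma condOne_le_condOneMajorant {G : ℕ} (hG : 6 ≤ G) {p : ℝ} (hp1 : 1 / (G : ℝ) ≤ p)
    (hp2 : p ≤ 2 / G) :
    G * p * (1 - p) ^ (G - 1) / (1 - (1 - p) ^ G - p ^ G)
      ≤ condOneMajorant (6 / G) (G * p - 1) := by
  obtain ⟨n, rfl⟩ : ∃ n, G = n + 1 := ⟨G - 1, by omega⟩
  set g : ℝ := ((n + 1 : ℕ) : ℝ) with hg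
  have hg6 : (6 : ℝ) ≤ g := by rw [hg]; exact_mod_cast hG
  have hg0 : 0 < g := by linarith
  have hp0 : 0 < p := lt_of_lt_of_le (by positivity) hp1
  have hx1 : 1 ≤ g * p := by rwa [div_le_iff₀' hg0] at hp1
  have hx2 : g * p ≤ 2 := by rwa [le_div_iff₀' hg0] at hp2
  have hp3 : p ≤ 1 / 3 := by nlinarith
  have he : 1 / g ≤ 1 / 6 := one_div_le_one_div_of_le (by norm_num) hg6
  have hu : 0 < (1 - p) ^ n := pow_pos (by linarith) n
  have hT := pow_mul_negBinomTaylor_le_one hp0.le (by linarith) n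
  have hP := mul_ratioMinorant_le (x := g * p) (e := 1 / g) (n := n) (p := p) (by linarith)
    (by positivity) he (by field_simp) (by rw [hg]; push_cast; field_simp; ring)
  have htail := pow_succ_le_pow_mul (x := g * p) (n := n) (by omega) hp0.le (by linarith)
    (by nlinarith) (by nlinarith)
  have hQP := one_le_condOneMajorant_mul_ratioMinorant (s := 6 / g) (t := g * p - 1)
    (by positivity) (by rw [div_le_one hg0]; exact hg6) (by linarith) (by linarith)
  rw [show 1 + (g * p - 1) = g * p by ring, show 6 / g / 6 = 1 / g by ring] at hQP
  have hD : (1 - p) ^ n * (g * p * ratioMinorant (g * p) (1 / g))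
      ≤ 1 - (1 - p) ^ (n + 1) - p ^ (n + 1) := by
    have := mul_le_mul_of_nonneg_left hP hu.le
    rw [pow_succ (1 - p)]
    linarith
  have hPpos : 0 < ratioMinorant (g * p) (1 / g) := by
    have hx : 0 ≤ g * p := by linarith
    have he0 : 0 ≤ 1 / g := by positivity
    unfold ratioMinorant
    generalize 1 / g = e at *
    have h1 : 0 ≤ 1 - e := by linarith
    have h2 : 0 ≤ 1 - e ^ 2 := by nlinarith
    have h3 : 0 ≤ 1 + 2 * e - 4 / 3 * e ^ 2 := by nlinarith
    have h5 : 0 ≤ (g * p) ^ 5 := pow_nonneg hx 5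
    have : 0 ≤ (1 - e) * (g * p) / 2 + (1 - e ^ 2) * (g * p) ^ 2 / 6
      + (1 + 2 * e - 4 / 3 * e ^ 2) * (g * p) ^ 3 / 24
      + (1 + 5 * e + 4 * e ^ 2) * (g * p) ^ 4 / 120 + (9 * e + 25 * e ^ 2) * (g * p) ^ 5 / 720
      + (1 + 14 * e + 70 * e ^ 2) * (g * p) ^ 6 / 5040
      + (1 + 20 * e + 154 * e ^ 2) * (g * p) ^ 7 / 40320 := by positivity
    linarith
  have hQpos : 0 ≤ condOneMajorant (6 / g) (g * p - 1) := by
    by_contra! hneg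
    nlinarith
  have hDpos := one_sub_pow_sub_pow_pos (G := n + 1) (by omega) hp0 (by linarith)
  rw [div_le_iff₀ hDpos, Nat.add_sub_cancel]
  calc g * p * (1 - p) ^ n = (1 - p) ^ n * (g * p) * 1 := by ring
    _ ≤ (1 - p) ^ n * (g * p) *
        (condOneMajorant (6 / g) (g * p - 1) * ratioMinorant (g * p) (1 / g)) := by gcongr
    _ = condOneMajorant (6 / g) (g * p - 1)
        * ((1 - p) ^ n * (g * p * ratioMinorant (g * p) (1 / g))) := by ring
    _ ≤ _ := mul_le_mul_of_nonneg_left hD hQpos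

lemma sum_Icc_one_binomial {G : ℕ} (hG : 1 ≤ G) (p : ℝ) :
    ∑ k ∈ Finset.Icc 1 (G - 1), (G.choose k : ℝ) * p ^ k * (1 - p) ^ (G - k)
      = 1 - (1 - p) ^ G - p ^ G := by
  obtain ⟨n, rfl⟩ : ∃ n, G = n + 1 := ⟨G - 1, by omega⟩
  have h := add_pow p (1 - p) (n + 1)
  rw [add_sub_cancel, one_pow, Finset.sum_range_succ, Finset.range_eq_Ico,
    Finset.sum_eq_sum_Ico_succ_bot (by omega)] at h
  have hI : Finset.Icc 1 (n + 1 - 1) = Finset.Ico (0 + 1) (n + 1) := by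
    ext k
    simp only [Finset.mem_Icc, Finset.mem_Ico]
    omega
  rw [hI, Finset.sum_congr rfl fun k _ ↦
    show _ = p ^ k * (1 - p) ^ (n + 1 - k) * ((n + 1).choose k : ℝ) by ring]
  simp only [Nat.sub_self, Nat.choose_self, Nat.choose_zero_right, pow_zero, Nat.sub_zero,
    Nat.cast_one, mul_one, one_mul] at h
  linarith

lemma overshootProb_eq_one {G : ℕ} (hG : 2 ≤ G) {p : ℝ} (hp0 : 0 < p) (hp1 : p < 1 / G) :
    overshootProb G p = 1 := by
  have hg : (2 : ℝ) ≤ G := by exact_mod_cast hG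
  have hx : G * p < 1 := by rwa [lt_div_iff₀' (by linarith)] at hp1
  have hfloor : ⌊(G : ℝ) * p⌋₊ = 0 := Nat.floor_eq_zero.2 hx
  rw [overshootProb, hfloor, zero_add, sum_Icc_one_binomial (by omega),
    div_self (one_sub_pow_sub_pow_pos hG hp0 (by nlinarith)).ne']

lemma overshootProb_eq_one_sub {G : ℕ} (hG : 2 ≤ G) {p : ℝ} (hp1 : 1 / (G : ℝ) < p)
    (hp2 : p < 2 / G) :
    overshootProb G p = 1 - G * p * (1 - p) ^ (G - 1) / (1 - (1 - p) ^ G - p ^ G) := by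
  have hg : (2 : ℝ) ≤ G := by exact_mod_cast hG
  have hx1 : 1 < G * p := by rwa [div_lt_iff₀' (by linarith)] at hp1
  have hx2 : G * p < 2 := by rwa [lt_div_iff₀' (by linarith)] at hp2
  have hp0 : 0 < p := lt_trans (by positivity) hp1
  have hfloor : ⌊(G : ℝ) * p⌋₊ = 1 := by
    rw [Nat.floor_eq_iff (by linarith)]
    norm_num
    exact ⟨hx1.le, hx2⟩
  have hD := one_sub_pow_sub_pow_pos hG hp0 (by nlinarith)
  have hsum := sum_Icc_one_binomial (G := G) (by omega) p
  have hI : Finset.Icc 1 (G - 1) = insert 1 (Finset.Icc 2 (G - 1)) := by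
    ext k
    simp only [Finset.mem_Icc, Finset.mem_insert]
    omega
  rw [hI, Finset.sum_insert (by simp), Nat.choose_one_right, pow_one] at hsum
  rw [overshootProb, hfloor, eq_sub_iff_add_eq, ← add_div, div_eq_one_iff_eq hD.ne']
  linarith

lemma integral_condOneMajorant (s : ℝ) :
    ∫ x in (1 : ℝ)..2, condOneMajorant s (x - 1) = 52649 / 120000 + s * (61 / 60000) := by
  have hderiv : ∀ x ∈ Set.uIcc (0 : ℝ) 1, HasDerivAt (fun t : ℝ ↦
      (2917 / 5000 + s * (107 / 5000)) * t + (-3431 / 20000 + s * (-53 / 5000)) * t ^ 2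
      + (463 / 15000 + s * (-49 / 3000)) * t ^ 3 + (-159 / 40000 + s * (131 / 20000)) * t ^ 4)
      (condOneMajorant s x) x := by
    intro x _
    refine HasDerivAt.congr_deriv
      (((((hasDerivAt_id' x).const_mul (2917 / 5000 + s * (107 / 5000))).add
      ((hasDerivAt_pow 2 x).const_mul (-3431 / 20000 + s * (-53 / 5000)))).add
      ((hasDerivAt_pow 3 x).const_mul (463 / 15000 + s * (-49 / 3000)))).add
      ((hasDerivAt_pow 4 x).const_mul (-159 / 40000 + s * (131 / 20000)))) ?_
    unfold condOneMajorant
    push_cast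
    ring
  have hcont : Continuous (condOneMajorant s) := by
    unfold condOneMajorant
    fun_prop
  rw [intervalIntegral.integral_comp_sub_right (condOneMajorant s), sub_self,
    show (2 : ℝ) - 1 = 1 by norm_num,
    intervalIntegral.integral_eq_sub_of_hasDerivAt hderiv (hcont.intervalIntegrable _ _)]
  ring

/-- For every integer `G ≥ 6`, the average of `P(p̂ > p | S)` over a uniformly
distributed difficulty `p` on `(0, 2/G)` exceeds `0.78`. -/
theorem avg_overshoot_prob_extreme (G : ℕ) (hG : 6 ≤ G) :
    (G : ℝ) / 2 * ∫ p in Set.Ioo (0 : ℝ) (2 / G), overshootProb G p > 0.78 := by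
  have hg : (6 : ℝ) ≤ G := by exact_mod_cast hG
  have hg0 : (0 : ℝ) < G := by linarith
  have h01 : (0 : ℝ) ≤ 1 / G := by positivity
  have h12 : 1 / (G : ℝ) ≤ 2 / G := by gcongr; norm_num
  set F : ℝ → ℝ := fun p ↦ G * p * (1 - p) ^ (G - 1) / (1 - (1 - p) ^ G - p ^ G) with hF
  set Q : ℝ → ℝ := fun x ↦ condOneMajorant (6 / G) (x - 1) with hQ
  have hQc : Continuous Q := by
    simp only [hQ, condOneMajorant]
    fun_prop
  have hFi : IntervalIntegrable F volume (1 / G) (2 / G) := by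
    apply ContinuousOn.intervalIntegrable_of_Icc h12
    refine ContinuousOn.div (by fun_prop) (by fun_prop) fun p hp ↦ ?_
    have h2 : 2 / (G : ℝ) < 1 := by rw [div_lt_one hg0]; linarith
    exact (one_sub_pow_sub_pow_pos (by omega) (lt_of_lt_of_le (by positivity) hp.1)
      (lt_of_le_of_lt hp.2 h2)).ne'
  have hE1 : Set.EqOn (overshootProb G) (fun _ ↦ 1) (Set.Ioo 0 (1 / (G : ℝ))) :=
    fun p hp ↦ overshootProb_eq_one (by omega) hp.1 hp.2
  have hE2 : Set.EqOn (overshootProb G) (fun p ↦ 1 - F p) (Set.Ioo (1 / (G : ℝ)) (2 / G)) :=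
    fun p hp ↦ overshootProb_eq_one_sub (by omega) hp.1 hp.2
  have hi1 : IntervalIntegrable (overshootProb G) volume 0 (1 / G) :=
    (intervalIntegrable_const (c := (1 : ℝ))).congr_uIoo
      (by rw [Set.uIoo_of_le h01]; exact hE1.symm)
  have hi2 : IntervalIntegrable (overshootProb G) volume (1 / G) (2 / G) :=
    (intervalIntegrable_const.sub hFi).congr_uIoo
      (by rw [Set.uIoo_of_le h12]; exact hE2.symm)
  have hmono : ∫ p in (1 / G : ℝ)..(2 / G), F p ≤ ∫ p in (1 / G : ℝ)..(2 / G), Q (G * p) :=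
    intervalIntegral.integral_mono_on h12 hFi
      (Continuous.intervalIntegrable (by fun_prop) _ _)
      fun p hp ↦ condOne_le_condOneMajorant hG hp.1 hp.2
  rw [intervalIntegral.integral_comp_mul_left Q hg0.ne', mul_div_cancel₀ _ hg0.ne',
    mul_div_cancel₀ _ hg0.ne', integral_condOneMajorant, smul_eq_mul] at hmono
  rw [← integral_Ioc_eq_integral_Ioo, ← intervalIntegral.integral_of_le (h01.trans h12),
    ← intervalIntegral.integral_add_adjacent_intervals hi1 hi2,
    intervalIntegral.integral_congr_Ioo_of_le h01 hE1,
    intervalIntegral.integral_congr_Ioo_of_le h12 hE2,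
    intervalIntegral.integral_sub intervalIntegrable_const hFi,
    intervalIntegral.integral_const, intervalIntegral.integral_const]
  have hs : 6 / (G : ℝ) ≤ 1 := by rw [div_le_one hg0]; exact hg
  have hmul := mul_le_mul_of_nonneg_left hmono hg0.le
  rw [mul_inv_cancel_left₀ hg0.ne'] at hmul
  have hlen : (G : ℝ) * (2 / G) = 2 := by field_simp
  simp only [smul_eq_mul, mul_one, sub_zero]
  generalize ∫ p in (1 / G : ℝ)..(2 / G), F p = I at hmul ⊢
  calc (G : ℝ) / 2 * (1 / G + (2 / G - 1 / G - I)) = (2 - G * I) / 2 := by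
        linear_combination hlen / 2
    _ > 0.78 := by norm_num; linarith
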